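/- arXiv:math/0511243 — 2 statements merged into one kernel-verified Lean document; each statement's English description precedes it below -/
import Mathlib

section
/- (Cahen–Mellin inversion) For every real λ > 0 and every real c > 0, the function t ↦ Γ(c + it) · λ^(-(c+it)) is integrable over ℝ and (1/(2π)) ∫_ℝ Γ(c + it) · λ^(-(c+it)) dt = e^(-λ). -/
open MeasureTheory Complex Real

/-- The Gamma function is bounded on vertical lines in the right half-plane by its value on the
real axis. -/
theorem norm_Gamma_le_Gamma_re {s : ℂ} (hs : 0 < s.re) :
    ‖Complex.Gamma s‖ ≤ Real.Gamma s.re := by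
  rw [Complex.Gamma_eq_integral hs, Real.Gamma_eq_integral hs, Complex.GammaIntegral]
  refine (norm_integral_le_integral_norm _).trans_eq ?_
  refine setIntegral_congr_fun measurableSet_Ioi fun x hx => ?_
  have hx : 0 < x := hx
  simp [Complex.norm_cpow_eq_rpow_re_of_pos hx, Complex.norm_exp]

theorem continuous_Gamma_vertical {c : ℝ} (hc : 0 < c) :
    Continuous fun t : ℝ => Complex.Gamma (c + t * Complex.I) := by
  refine continuous_iff_continuousAt.2 fun t => ?_
  have h : ContinuousAt Complex.Gamma (c + t * Complex.I) := by
    refine (Complex.differentiableAt_Gamma _ fun m hm => ?_).continuousAt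
    have := congrArg Complex.re hm
    simp at this
    have : (0 : ℝ) ≤ m := m.cast_nonneg
    linarith
  exact h.comp (f := fun t : ℝ => (c + t * Complex.I : ℂ)) (by fun_prop)

theorem norm_Gamma_vertical_le {c : ℝ} (hc : 0 < c) (t : ℝ) :
    ‖Complex.Gamma (c + t * Complex.I)‖ ≤
      Real.Gamma (c + 2) * (1 + 1 / c ^ 2) * (1 + t ^ 2)⁻¹ := by
  set s : ℂ := c + t * Complex.I with hs
  have hre : s.re = c := by simp [hs]
  have him : s.im = t := by simp [hs]
  have hs0 : s ≠ 0 := fun h => by simp [h] at hre; linarith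
  have hs1 : s + 1 ≠ 0 := fun h => by
    have := congrArg Complex.re h
    simp [hre] at this
    linarith
  have hGamma : Complex.Gamma (s + 1 + 1) = (s + 1) * (s * Complex.Gamma s) := by
    rw [Complex.Gamma_add_one _ hs1, Complex.Gamma_add_one _ hs0]
  have hbound : ‖Complex.Gamma (s + 1 + 1)‖ ≤ Real.Gamma (c + 2) := by
    have h := norm_Gamma_le_Gamma_re (s := s + 1 + 1) (by simp [hre]; linarith)
    have hre2 : (s + 1 + 1).re = c + 2 := by simp [hre]; ring
    rwa [hre2] at h
  have hsq : ‖s‖ ^ 2 = c ^ 2 + t ^ 2 := by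
    rw [Complex.sq_norm, Complex.normSq_apply, hre, him]; ring
  have hle : ‖s‖ ≤ ‖s + 1‖ := by
    refine (sq_le_sq₀ (norm_nonneg _) (norm_nonneg _)).1 ?_
    rw [hsq, Complex.sq_norm, Complex.normSq_apply]
    simp only [Complex.add_re, Complex.add_im, Complex.one_re, Complex.one_im, hre, him]
    nlinarith
  have hmul : (c ^ 2 + t ^ 2) * ‖Complex.Gamma s‖ ≤ Real.Gamma (c + 2) := by
    refine le_trans ?_ hbound
    rw [hGamma, norm_mul, norm_mul, ← mul_assoc, ← hsq, sq]
    gcongr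
  have hcmp : 1 + t ^ 2 ≤ (1 + 1 / c ^ 2) * (c ^ 2 + t ^ 2) := by
    have : (1 + 1 / c ^ 2) * (c ^ 2 + t ^ 2) = 1 + t ^ 2 + (c ^ 2 + t ^ 2 / c ^ 2) := by
      field_simp
      ring
    rw [this]
    have : 0 ≤ c ^ 2 + t ^ 2 / c ^ 2 := by positivity
    linarith
  rw [← div_eq_mul_inv, le_div_iff₀ (by positivity)]
  calc ‖Complex.Gamma s‖ * (1 + t ^ 2)
      ≤ ‖Complex.Gamma s‖ * ((1 + 1 / c ^ 2) * (c ^ 2 + t ^ 2)) := by gcongr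
    _ = (c ^ 2 + t ^ 2) * ‖Complex.Gamma s‖ * (1 + 1 / c ^ 2) := by ring
    _ ≤ Real.Gamma (c + 2) * (1 + 1 / c ^ 2) := by gcongr

theorem verticalIntegrable_Gamma {c : ℝ} (hc : 0 < c) :
    VerticalIntegrable Complex.Gamma c :=
  (integrable_inv_one_add_sq.const_mul (Real.Gamma (c + 2) * (1 + 1 / c ^ 2))).mono'
    (continuous_Gamma_vertical hc).aestronglyMeasurable
    (Filter.Eventually.of_forall (norm_Gamma_vertical_le hc))

theorem mellin_exp_neg {s : ℂ} (hs : 0 < s.re) :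
    mellin (fun x : ℝ => (Real.exp (-x) : ℂ)) s = Complex.Gamma s := by
  rw [Complex.Gamma_eq_integral hs, Complex.GammaIntegral_eq_mellin]

theorem mellinConvergent_exp_neg {s : ℂ} (hs : 0 < s.re) :
    MellinConvergent (fun x : ℝ => (Real.exp (-x) : ℂ)) s := by
  simpa only [MellinConvergent, smul_eq_mul, mul_comm] using Complex.GammaIntegral_convergent hs

/-- Cahen–Mellin inversion: for `λ > 0` and `c > 0`, the function
`t ↦ Γ(c + it) · λ^(-(c+it))` is integrable over `ℝ` and
`(1/(2π)) ∫_ℝ Γ(c + it) λ^(-(c+it)) dt = e^(-λ)`. -/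
theorem cahen_mellin_inversion (l : ℝ) (hl : 0 < l) (c : ℝ) (hc : 0 < c) :
    Integrable (fun t : ℝ => Complex.Gamma (c + t * Complex.I) *
        (l : ℂ) ^ (-(c + t * Complex.I))) ∧
      (1 / (2 * Real.pi) : ℂ) *
        ∫ t : ℝ, Complex.Gamma (c + t * Complex.I) * (l : ℂ) ^ (-(c + t * Complex.I)) =
          Real.exp (-l) := by
  have hl0 : (l : ℂ) ≠ 0 := by exact_mod_cast hl.ne'
  have hmellin (t : ℝ) : mellin (fun x : ℝ => (Real.exp (-x) : ℂ)) (c + t * Complex.I) =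
      Complex.Gamma (c + t * Complex.I) := mellin_exp_neg (by simpa using hc)
  constructor
  · refine Integrable.mul_bdd (c := l ^ (-c)) (verticalIntegrable_Gamma hc) ?_ ?_
    · refine Continuous.aestronglyMeasurable ?_
      exact Continuous.const_cpow (by fun_prop) (Or.inl hl0)
    · refine Filter.Eventually.of_forall fun t => ?_
      simp [Complex.norm_cpow_eq_rpow_re_of_pos hl]
  · have hvert : VerticalIntegrable (mellin fun x : ℝ => (Real.exp (-x) : ℂ)) c := by
      simpa only [VerticalIntegrable, hmellin] using verticalIntegrable_Gamma hc
    have h := mellinInv_mellin_eq c (fun x : ℝ => (Real.exp (-x) : ℂ)) hl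
      (mellinConvergent_exp_neg (by simpa using hc)) hvert (by fun_prop)
    simp only [mellinInv, hmellin, smul_eq_mul] at h
    rw [← h, Complex.real_smul]
    simp only [mul_comm (Complex.Gamma _)]
    push_cast
    rfl
end

section
/- Let φ : ℂ → ℂ be entire, let R > 0 be real, and let m be a natural number with φ(-m) = 0. Then the function z ↦ (z + m) · Γ(z) · R^(-2(z+m)) · φ(z) / (2(z + m)) tends to (-1)^m · φ'(-m) / (2 · m!) as z tends to -m within ℂ \ {-m}. In particular this residue is independent of R. -/
open Filter Complex

/-- The Gamma function has a simple pole at `-m` with residue `(-1) ^ m / m!`. -/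
theorem tendsto_add_nat_mul_Gamma (m : ℕ) :
    Tendsto (fun z : ℂ => (z + m) * Complex.Gamma z)
      (nhdsWithin (-(m : ℂ)) {-(m : ℂ)}ᶜ) (nhds ((-1) ^ m / Nat.factorial m)) := by
  induction m with
  | zero => simpa using tendsto_self_mul_Gamma_nhds_zero
  | succ m ih =>
    have hm : (m : ℂ) + 1 ≠ 0 := Nat.cast_add_one_ne_zero m
    have hneg : -((m + 1 : ℕ) : ℂ) ≠ 0 := by
      push_cast
      exact neg_ne_zero.mpr hm
    have hshift : Tendsto (fun z : ℂ => z + 1)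
        (nhdsWithin (-((m + 1 : ℕ) : ℂ)) {-((m + 1 : ℕ) : ℂ)}ᶜ)
        (nhdsWithin (-(m : ℂ)) {-(m : ℂ)}ᶜ) := by
      refine tendsto_nhdsWithin_iff.mpr ⟨?_, ?_⟩
      · have hc : ContinuousAt (fun z : ℂ => z + 1) (-((m + 1 : ℕ) : ℂ)) := by fun_prop
        have h := hc.tendsto
        have he : -((m + 1 : ℕ) : ℂ) + 1 = -(m : ℂ) := by push_cast; ring
        rw [he] at h
        exact h.mono_left nhdsWithin_le_nhds
      · filter_upwards [self_mem_nhdsWithin] with z hz hz'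
        apply hz
        rw [Set.mem_singleton_iff] at hz' ⊢
        push_cast
        linear_combination hz'
    have hid : Tendsto (fun z : ℂ => z)
        (nhdsWithin (-((m + 1 : ℕ) : ℂ)) {-((m + 1 : ℕ) : ℂ)}ᶜ)
        (nhds (-((m + 1 : ℕ) : ℂ))) := nhdsWithin_le_nhds
    have hlim := (ih.comp hshift).div hid hneg
    have hval : (-1 : ℂ) ^ m / Nat.factorial m / -((m + 1 : ℕ) : ℂ) =
        (-1) ^ (m + 1) / Nat.factorial (m + 1) := by
      have hf : (Nat.factorial m : ℂ) ≠ 0 := Nat.cast_ne_zero.mpr m.factorial_ne_zero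
      rw [Nat.factorial_succ]
      push_cast
      field_simp
      ring
    rw [hval] at hlim
    refine hlim.congr' ?_
    filter_upwards [hid.eventually_ne hneg] with z hz
    simp only [Function.comp_apply, Pi.div_apply]
    rw [Complex.Gamma_add_one z hz]
    push_cast
    field_simp
    ring

/-- Scalar model of a residue at a nonpositive integer where the entire factor
vanishes: if `φ` is entire, `R > 0`, and `φ(-m) = 0`, then
`(z + m)·Γ(z)·R^(-2(z+m))·φ(z)/(2(z+m)) → (-1)^m·φ'(-m)/(2·m!)` as `z → -m`
in `ℂ \ {-m}`; in particular this residue is independent of `R`. -/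
theorem residue_at_gamma_pole_indep (φ : ℂ → ℂ) (hφ : Differentiable ℂ φ)
    (R : ℝ) (hR : 0 < R) (m : ℕ) (hφm : φ (-(m : ℂ)) = 0) :
    Tendsto (fun z : ℂ =>
        (z + m) * Complex.Gamma z * (R : ℂ) ^ (-2 * (z + m)) * φ z / (2 * (z + m)))
      (nhdsWithin (-(m : ℂ)) {-(m : ℂ)}ᶜ)
      (nhds ((-1) ^ m * deriv φ (-(m : ℂ)) / (2 * Nat.factorial m))) := by
  have hslope := hasDerivAt_iff_tendsto_slope.mp (hφ (-(m : ℂ))).hasDerivAt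
  have hpow : Tendsto (fun z : ℂ => (R : ℂ) ^ (-2 * (z + m)))
      (nhdsWithin (-(m : ℂ)) {-(m : ℂ)}ᶜ) (nhds 1) := by
    have hR' : (R : ℂ) ≠ 0 := Complex.ofReal_ne_zero.mpr hR.ne'
    have hlin : ContinuousAt (fun z : ℂ => -2 * (z + m)) (-(m : ℂ)) := by fun_prop
    have h := (hlin.const_cpow (Or.inl hR')).tendsto
    simp only [neg_add_cancel, mul_zero, cpow_zero] at h
    exact h.mono_left nhdsWithin_le_nhds
  have hlim := (((tendsto_add_nat_mul_Gamma m).mul hpow).mul hslope).div_const 2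
  have hval : (-1 : ℂ) ^ m / Nat.factorial m * 1 * deriv φ (-(m : ℂ)) / 2 =
      (-1) ^ m * deriv φ (-(m : ℂ)) / (2 * Nat.factorial m) := by
    rw [mul_one, div_mul_eq_mul_div, div_div, mul_comm (Nat.factorial m : ℂ)]
  rw [hval] at hlim
  refine hlim.congr fun z => ?_
  rw [slope_def_field, hφm, sub_zero, sub_neg_eq_add, mul_div_assoc', div_div,
    mul_comm (z + (m : ℂ)) 2]
end
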